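/- arXiv:1406.0647 — 8 statements merged into one kernel-verified Lean document; each statement's English description precedes it below -/
import Mathlib

section
/- Let g be a line in ℝ³, let m₁, m₂, m₃ be pairwise distinct points on g, and let m₄ be a point not on g. Then there do not exist a line L and a radius r > 0 such that dist(mᵢ, L) = r for i = 1, 2, 3 and the line through m₁ and m₄ is contained in the cylinder of revolution {x ∈ ℝ³ : dist(x, L) = r}. -/
open Metric

noncomputable section

local notation "E3" => EuclideanSpace ℝ (Fin 3)

/-- A line in `ℝ³` is a one-dimensional affine subspace. -/
def IsLine (L : AffineSubspace ℝ (EuclideanSpace ℝ (Fin 3))) : Prop :=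
  Module.finrank ℝ L.direction = 1

/-- The cylinder of revolution with axis `L` and radius `r`. -/
def Cylinder (L : AffineSubspace ℝ (EuclideanSpace ℝ (Fin 3))) (r : ℝ) :
    Set (EuclideanSpace ℝ (Fin 3)) :=
  {x | Metric.infDist x (L : Set (EuclideanSpace ℝ (Fin 3))) = r}

lemma aux_dir (L : AffineSubspace ℝ E3) (hL : IsLine L) (r : ℝ) (x v : E3) (s : ℝ)
    (hs0 : s ≠ 0) (hs1 : s ≠ 1)
    (h0 : Metric.infDist x (L : Set E3) = r)
    (h1 : Metric.infDist (x + v) (L : Set E3) = r)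
    (h2 : Metric.infDist (x + s • v) (L : Set E3) = r) : v ∈ L.direction := by
  have hne : Nonempty L := by
    by_contra hcon
    have hb : L = ⊥ := by
      rw [← AffineSubspace.coe_eq_bot_iff]
      exact Set.not_nonempty_iff_eq_empty.1 (fun hh => hcon hh.to_subtype)
    unfold IsLine at hL
    rw [hb, AffineSubspace.direction_bot] at hL
    simp at hL
  obtain ⟨p, hp⟩ : ∃ p : E3, ∀ y : E3, Metric.infDist y (L : Set E3)
      = ‖(y - p) - L.direction.starProjection (y - p)‖ := by
    refine ⟨(Classical.arbitrary L : L), fun y => ?_⟩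
    rw [← EuclideanGeometry.dist_orthogonalProjection_eq_infDist,
      EuclideanGeometry.orthogonalProjection_apply', dist_eq_norm]
    congr 1
    simp only [vsub_eq_sub, vadd_eq_add, Submodule.coe_orthogonalProjectionOnto_apply]
    abel
  rw [hp] at h0 h1 h2
  set a := (x - p) - L.direction.starProjection (x - p) with ha
  set w := v - L.direction.starProjection v with hw
  have e1 : (x + v - p) - L.direction.starProjection (x + v - p) = a + w := by
    rw [ha, hw, show x + v - p = (x - p) + v by abel, map_add]; abel
  have e2 : (x + s • v - p) - L.direction.starProjection (x + s • v - p) = a + s • w := by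
    rw [ha, hw, show x + s • v - p = (x - p) + s • v by abel, map_add, map_smul, smul_sub]; abel
  rw [e1] at h1
  rw [e2] at h2
  have q1 := norm_add_sq_real a w
  have q2 := norm_add_sq_real a (s • w)
  rw [h1, h0] at q1
  rw [h2, h0, inner_smul_right, norm_smul, mul_pow, Real.norm_eq_abs, sq_abs] at q2
  have hz : s * (s - 1) * ‖w‖ ^ 2 = 0 := by linear_combination s * q1 - q2
  have hw0 : w = 0 := by
    have : s - 1 ≠ 0 := sub_ne_zero.2 hs1
    simpa [hs0, this] using hz
  rw [← Submodule.starProjection_eq_self_iff]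
  exact (sub_eq_zero.1 hw0).symm

/-- If `m₁, m₂, m₃` are pairwise distinct points on a line `g` and `m₄ ∉ g`, then
there is no cylinder of revolution passing through `m₁, m₂, m₃` and containing the
line through `m₁` and `m₄` as a ruling. -/
theorem no_cylinder_through_three_points_of_line_with_ruling
    (g : AffineSubspace ℝ E3) (hg : IsLine g)
    (m₁ m₂ m₃ m₄ : E3)
    (h₁ : m₁ ∈ g) (h₂ : m₂ ∈ g) (h₃ : m₃ ∈ g)
    (h₁₂ : m₁ ≠ m₂) (h₁₃ : m₁ ≠ m₃) (h₂₃ : m₂ ≠ m₃)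
    (h₄ : m₄ ∉ g) :
    ¬ ∃ (L : AffineSubspace ℝ E3) (r : ℝ), IsLine L ∧ 0 < r ∧
      Metric.infDist m₁ (L : Set E3) = r ∧
      Metric.infDist m₂ (L : Set E3) = r ∧
      Metric.infDist m₃ (L : Set E3) = r ∧
      (affineSpan ℝ ({m₁, m₄} : Set E3) : Set E3) ⊆ Cylinder L r := by
  rintro ⟨L, r, hL, -, d1, d2, d3, hsub⟩
  have hv0 : m₂ - m₁ ≠ 0 := sub_ne_zero.2 h₁₂.symm
  have hvg : m₂ - m₁ ∈ g.direction := AffineSubspace.vsub_mem_direction h₂ h₁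
  have hug : m₃ - m₁ ∈ g.direction := AffineSubspace.vsub_mem_direction h₃ h₁
  obtain ⟨s, hs⟩ := (finrank_eq_one_iff_of_nonzero' (⟨m₂ - m₁, hvg⟩ : g.direction)
    (by simpa [Subtype.ext_iff] using hv0)).1 hg ⟨m₃ - m₁, hug⟩
  replace hs : s • (m₂ - m₁) = m₃ - m₁ := congrArg Subtype.val hs
  have hvL : m₂ - m₁ ∈ L.direction := by
    refine aux_dir L hL r m₁ (m₂ - m₁) s ?_ ?_ d1 (by simpa using d2) (by rw [hs]; simpa using d3)
    · rintro rfl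
      rw [zero_smul] at hs
      exact h₁₃ (sub_eq_zero.1 hs.symm).symm
    · rintro rfl
      rw [one_smul] at hs
      exact h₂₃ (sub_left_injective hs)
  have hline : ∀ t : ℝ, Metric.infDist (m₁ + t • (m₄ - m₁)) (L : Set E3) = r := by
    intro t
    have hm := hsub (AffineMap.lineMap_mem_affineSpan_pair t m₁ m₄)
    have hm' : Metric.infDist (AffineMap.lineMap m₁ m₄ t) (L : Set E3) = r := hm
    rwa [AffineMap.lineMap_apply, vsub_eq_sub, vadd_eq_add, add_comm] at hm'
  have hwL : m₄ - m₁ ∈ L.direction :=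
    aux_dir L hL r m₁ (m₄ - m₁) 2 (by norm_num) (by norm_num) d1
      (by simpa using hline 1) (hline 2)
  obtain ⟨c, hc⟩ := (finrank_eq_one_iff_of_nonzero' (⟨m₂ - m₁, hvL⟩ : L.direction)
    (by simpa [Subtype.ext_iff] using hv0)).1 hL ⟨m₄ - m₁, hwL⟩
  replace hc : c • (m₂ - m₁) = m₄ - m₁ := congrArg Subtype.val hc
  apply h₄
  have := AffineSubspace.vadd_mem_of_mem_direction (g.direction.smul_mem c hvg) h₁
  rw [hc] at this
  simpa using this

end
end

section
/- Let L be a line in ℝ³ and r ≥ 0. If three pairwise distinct collinear points each lie at distance r from L, then the line g through them is parallel to L (its direction submodule equals that of L), and consequently every point of g is at distance r from L. -/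
open Metric

noncomputable section

local notation "E3" => EuclideanSpace ℝ (Fin 3)

theorem infDist_eq_norm_aux (L : AffineSubspace ℝ E3) (q : E3) (hq : q ∈ L) (x : E3) :
    Metric.infDist x (L : Set E3) = ‖L.directionᗮ.starProjection (x - q)‖ := by
  haveI : Nonempty L := ⟨q, hq⟩
  rw [← EuclideanGeometry.dist_orthogonalProjection_eq_infDist, dist_eq_norm]
  have h1 := EuclideanGeometry.vsub_orthogonalProjection_mem_direction_orthogonal L x
  have h2 : ((EuclideanGeometry.orthogonalProjection L x : L) : E3) - q ∈ L.direction :=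
    AffineSubspace.vsub_mem_direction (EuclideanGeometry.orthogonalProjection_mem x) hq
  rw [vsub_eq_sub] at h1
  generalize ((EuclideanGeometry.orthogonalProjection L x : L) : E3) = y at *
  have h3 : x - q = (x - y) + (y - q) := by abel
  rw [h3, map_add, Submodule.starProjection_eq_self_iff.mpr h1,
    Submodule.starProjection_orthogonal_apply_eq_zero h2, add_zero]

theorem norm_line_aux (a b : E3) (t r : ℝ) (h0 : ‖a‖ = r) (h1 : ‖a + b‖ = r)
    (h2 : ‖a + t • b‖ = r) (ht0 : t ≠ 0) (ht1 : t ≠ 1) : b = 0 := by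
  have e1 := norm_add_sq_real a b
  have e2 := norm_add_sq_real a (t • b)
  rw [h1, h0] at e1
  rw [h2, h0, inner_smul_right, norm_smul, mul_pow, Real.norm_eq_abs, sq_abs] at e2
  have e3 : t * (t - 1) * ‖b‖ ^ 2 = 0 := by linear_combination t * e1 - e2
  have e4 : t * (t - 1) ≠ 0 := mul_ne_zero ht0 (sub_ne_zero.mpr ht1)
  simpa [e4] using e3

/-- If three pairwise distinct collinear points all lie at distance `r` from a
line `L`, then the line `g` through them is parallel to `L` (same direction
submodule) and every point of `g` is at distance `r` from `L`. -/
theorem collinear_points_equidistant_from_line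
    (L : AffineSubspace ℝ E3) (hL : IsLine L) (r : ℝ) (hr : 0 ≤ r)
    (p₁ p₂ p₃ : E3)
    (h₁₂ : p₁ ≠ p₂) (h₁₃ : p₁ ≠ p₃) (h₂₃ : p₂ ≠ p₃)
    (hcol : Collinear ℝ ({p₁, p₂, p₃} : Set E3))
    (hd₁ : Metric.infDist p₁ (L : Set E3) = r)
    (hd₂ : Metric.infDist p₂ (L : Set E3) = r)
    (hd₃ : Metric.infDist p₃ (L : Set E3) = r) :
    (affineSpan ℝ ({p₁, p₂, p₃} : Set E3)).direction = L.direction ∧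
    ∀ x ∈ affineSpan ℝ ({p₁, p₂, p₃} : Set E3),
      Metric.infDist x (L : Set E3) = r := by
  have hne : (L : Set E3).Nonempty := by
    rw [AffineSubspace.nonempty_iff_ne_bot]
    rintro rfl
    rw [IsLine, AffineSubspace.direction_bot, finrank_bot] at hL
    exact zero_ne_one hL
  obtain ⟨q, hq⟩ := hne
  have key := infDist_eq_norm_aux L q hq
  have hspan : affineSpan ℝ ({p₁, p₂, p₃} : Set E3) = line[ℝ, p₁, p₂] :=
    (hcol.affineSpan_eq_of_ne (by simp) (by simp) h₁₂).symm
  have hpar : ∀ x ∈ affineSpan ℝ ({p₁, p₂, p₃} : Set E3), ∃ t : ℝ,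
      x = p₁ + t • (p₂ - p₁) := by
    intro x hx
    rw [hspan, mem_affineSpan_pair_iff_exists_lineMap_eq] at hx
    obtain ⟨t, rfl⟩ := hx
    exact ⟨t, by rw [AffineMap.lineMap_apply_module']; abel⟩
  have hf : ∀ t : ℝ, L.directionᗮ.starProjection (p₁ + t • (p₂ - p₁) - q) =
      L.directionᗮ.starProjection (p₁ - q) + t • L.directionᗮ.starProjection (p₂ - p₁) := by
    intro t
    rw [← map_smul, ← map_add]
    congr 1
    abel
  have hb : L.directionᗮ.starProjection (p₂ - p₁) = 0 := by
    obtain ⟨t, ht⟩ := hpar p₃ (subset_affineSpan ℝ _ (by simp))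
    refine norm_line_aux (L.directionᗮ.starProjection (p₁ - q)) _ t r ?_ ?_ ?_ ?_ ?_
    · rw [← key, hd₁]
    · rw [← map_add, show p₁ - q + (p₂ - p₁) = p₂ - q by abel, ← key, hd₂]
    · rw [← hf, ← ht, ← key, hd₃]
    · rintro rfl
      exact h₁₃ (by simp [ht])
    · rintro rfl
      exact h₂₃ (by simp [ht])
  constructor
  · have hmem : p₂ - p₁ ∈ L.direction := by
      rw [Submodule.starProjection_apply_eq_zero_iff, Submodule.orthogonal_orthogonal] at hb
      exact hb
    rw [hspan, direction_affineSpan, vectorSpan_pair_rev, vsub_eq_sub]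
    refine Submodule.eq_of_le_of_finrank_eq
      ((Submodule.span_singleton_le_iff_mem _ _).mpr hmem) ?_
    rw [finrank_span_singleton (sub_ne_zero.mpr h₁₂.symm)]
    exact hL.symm
  · intro x hx
    obtain ⟨t, rfl⟩ := hpar x hx
    rw [key, hf, hb, smul_zero, add_zero, ← key, hd₁]

end
end

section
/- Let L be the line through a point a ∈ ℝ³ with unit direction vector u, let r > 0, and let q ∈ ℝ³ satisfy dist(q, L) = r. Put n := (q − a) − ⟨q − a, u⟩·u. Then for every x ∈ ℝ³ with dist(x, L) ≤ r one has ⟨x − q, n⟩ ≤ 0, and equality holds if and only if x − q is a scalar multiple of u. In particular, every point of the cylinder {x : dist(x, L) = r} that does not lie on the ruling through q lies strictly on one side of the tangent plane {x : ⟨x − q, n⟩ = 0} along that ruling. -/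
open Metric
open scoped RealInnerProductSpace

noncomputable section

local notation "E3" => EuclideanSpace ℝ (Fin 3)

theorem cyl_norm_sq (v u : E3) (hu : ‖u‖ = 1) (t : ℝ) :
    ‖v - t • u‖ ^ 2 = ‖v‖ ^ 2 - 2 * t * ⟪v, u⟫ + t ^ 2 := by
  rw [norm_sub_sq_real, inner_smul_right, norm_smul, hu, mul_one, Real.norm_eq_abs, sq_abs]
  ring

theorem cyl_infDist (a u : E3) (hu : ‖u‖ = 1) (x : E3) :
    Metric.infDist x ((AffineSubspace.mk' a (ℝ ∙ u) : AffineSubspace ℝ E3) : Set E3)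
      = ‖(x - a) - ⟪x - a, u⟫ • u‖ := by
  apply le_antisymm
  · have h : (⟪x - a, u⟫ • u + a) ∈
        ((AffineSubspace.mk' a (ℝ ∙ u) : AffineSubspace ℝ E3) : Set E3) := by
      rw [SetLike.mem_coe, AffineSubspace.mem_mk', vsub_eq_sub, add_sub_cancel_right]
      exact Submodule.smul_mem _ _ (Submodule.mem_span_singleton_self u)
    refine (Metric.infDist_le_dist_of_mem h).trans (le_of_eq ?_)
    rw [dist_eq_norm]
    congr 1
    abel
  · refine (Metric.le_infDist ⟨a, AffineSubspace.self_mem_mk' _ _⟩).2 ?_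
    intro y hy
    rw [SetLike.mem_coe, AffineSubspace.mem_mk', vsub_eq_sub,
      Submodule.mem_span_singleton] at hy
    obtain ⟨t, ht⟩ := hy
    have e : x - y = (x - a) - t • u := by rw [ht]; abel
    rw [dist_eq_norm, e]
    refine (sq_le_sq₀ (norm_nonneg _) (norm_nonneg _)).1 ?_
    rw [cyl_norm_sq _ _ hu, cyl_norm_sq _ _ hu]
    nlinarith [sq_nonneg (t - ⟪x - a, u⟫)]

/-- Tangent-plane property of a cylinder of revolution: let `L` be the line
through `a` with unit direction `u`, let `q` be at distance `r > 0` from `L`,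
and let `n` be the foot-to-`q` normal vector. Then every point `x` with
`dist(x, L) ≤ r` satisfies `⟪x - q, n⟫ ≤ 0` with equality iff `x - q` is a
multiple of `u`. -/
theorem cylinder_tangent_plane
    (a u q : E3) (hu : ‖u‖ = 1) (r : ℝ) (hr : 0 < r)
    (hq : Metric.infDist q ((AffineSubspace.mk' a (ℝ ∙ u) : AffineSubspace ℝ E3) : Set E3) = r)
    (n : E3) (hn : n = (q - a) - ⟪q - a, u⟫ • u) :
    ∀ x : E3,
      Metric.infDist x ((AffineSubspace.mk' a (ℝ ∙ u) : AffineSubspace ℝ E3) : Set E3) ≤ r →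
      (⟪x - q, n⟫ ≤ 0 ∧ (⟪x - q, n⟫ = 0 ↔ ∃ t : ℝ, x - q = t • u)) := by
  intro x hx
  rw [cyl_infDist a u hu] at hq hx
  rw [← hn] at hq
  obtain ⟨m, hm⟩ : ∃ m, m = (x - a) - ⟪x - a, u⟫ • u := ⟨_, rfl⟩
  rw [← hm] at hx
  have huu : ⟪u, u⟫ = 1 := by rw [real_inner_self_eq_norm_sq, hu]; norm_num
  have hun : ⟪u, n⟫ = 0 := by
    rw [hn, inner_sub_right, inner_smul_right, huu, real_inner_comm]; ring
  have hd : x - q = (m - n) + (⟪x - a, u⟫ - ⟪q - a, u⟫) • u := by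
    rw [hm, hn, sub_smul]; abel
  have h1 : ⟪x - q, n⟫ = ⟪m, n⟫ - r ^ 2 := by
    rw [hd, inner_add_left, inner_smul_left, hun, inner_sub_left,
      real_inner_self_eq_norm_sq, hq]
    simp
  have h2 := norm_sub_sq_real m n
  rw [hq] at h2
  have h3 : ‖m‖ ^ 2 ≤ r ^ 2 := by gcongr
  refine ⟨by nlinarith [sq_nonneg ‖m - n‖], ?_, ?_⟩
  · intro h0
    have h4 : ‖m - n‖ ^ 2 = 0 := le_antisymm (by linarith) (sq_nonneg _)
    have h5 : m - n = 0 := norm_eq_zero.1 (pow_eq_zero_iff (two_ne_zero)|>.1 h4)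
    exact ⟨_, by rw [hd, h5, zero_add]⟩
  · rintro ⟨t, ht⟩
    rw [ht, inner_smul_left, hun, mul_zero]

end
end

section
/- Let a₂, a₃, b₃, A₂, A₃, B₃ be real numbers with a₂·A₂·b₃·B₃ ≠ 0. Then the three equations (B₃ − b₃)(A₂ − a₂) = 0, (B₃ + b₃)(A₂ + a₂) = 0 and A₃·a₂ − A₂·a₃ = 0 hold simultaneously if and only if (A₂, A₃, B₃) = (−a₂, −a₃, b₃) or (A₂, A₃, B₃) = (a₂, a₃, −b₃); in either of these two cases the linear map T : ℝ² → ℝ² determined by T(a₂, 0) = (A₂, 0) and T(a₃, b₃) = (A₃, B₃) is a linear isometry. Consequently, if the triangles with vertices (0,0), (a₂,0), (a₃,b₃) and (0,0), (A₂,0), (A₃,B₃) are not related by a linear isometry of ℝ², then the homogeneous quadratic polynomial q(e₀, e₃) = (B₃ − b₃)(A₂ − a₂)·e₀² + (B₃ + b₃)(A₂ + a₂)·e₃² + 2(A₃·a₂ − A₂·a₃)·e₀·e₃ is not the zero polynomial. -/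
noncomputable section

local notation "E2" => EuclideanSpace ℝ (Fin 2)

/-- The point of the Euclidean plane with coordinates `(x, y)`. -/
def pt2 (x y : ℝ) : EuclideanSpace ℝ (Fin 2) :=
  (WithLp.equiv 2 (Fin 2 → ℝ)).symm ![x, y]

theorem pent_algebra (a₂ a₃ b₃ A₂ A₃ B₃ : ℝ) (h : a₂ * A₂ * b₃ * B₃ ≠ 0) :
    (((B₃ - b₃) * (A₂ - a₂) = 0 ∧ (B₃ + b₃) * (A₂ + a₂) = 0 ∧
        A₃ * a₂ - A₂ * a₃ = 0) ↔
      ((A₂, A₃, B₃) = (-a₂, -a₃, b₃) ∨ (A₂, A₃, B₃) = (a₂, a₃, -b₃))) := by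
  have ha : a₂ ≠ 0 := by rintro rfl; simp at h
  have hb : b₃ ≠ 0 := by rintro rfl; simp at h
  simp only [Prod.mk.injEq]
  constructor
  · rintro ⟨h1, h2, h3⟩
    rcases mul_eq_zero.1 h1 with h1 | h1 <;> rcases mul_eq_zero.1 h2 with h2 | h2
    · exact absurd (by linarith) hb
    · left
      have e : A₂ = -a₂ := by linarith
      subst e
      exact ⟨rfl, mul_right_cancel₀ ha (by linarith), by linarith⟩
    · right
      have e : A₂ = a₂ := by linarith
      subst e
      exact ⟨rfl, mul_right_cancel₀ ha (by linarith), by linarith⟩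
    · exact absurd (by linarith) ha
  · rintro (⟨rfl, rfl, rfl⟩ | ⟨rfl, rfl, rfl⟩) <;> refine ⟨?_, ?_, ?_⟩ <;> ring

theorem pent_norm (c d : ℝ) (hc : c ^ 2 = 1) (hd : d ^ 2 = 1)
    (x : EuclideanSpace ℝ (Fin 2)) : ‖pt2 (c * x 0) (d * x 1)‖ = ‖x‖ := by
  simp [EuclideanSpace.norm_eq, Fin.sum_univ_two, pt2, mul_pow, hc, hd]

def pentIso (c d : ℝ) (hc : c ^ 2 = 1) (hd : d ^ 2 = 1) :
    EuclideanSpace ℝ (Fin 2) →ₗᵢ[ℝ] EuclideanSpace ℝ (Fin 2) where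
  toFun x := pt2 (c * x 0) (d * x 1)
  map_add' x y := by ext i; fin_cases i <;> simp [pt2] <;> ring
  map_smul' r x := by ext i; fin_cases i <;> simp [pt2] <;> ring
  norm_map' x := pent_norm c d hc hd x

theorem pentIso_apply (c d : ℝ) (hc : c ^ 2 = 1) (hd : d ^ 2 = 1) (x y : ℝ) :
    pentIso c d hc hd (pt2 x y) = pt2 (c * x) (d * y) := rfl

theorem pent_unique (a₂ a₃ b₃ : ℝ) (ha : a₂ ≠ 0) (hb : b₃ ≠ 0)
    (T S : EuclideanSpace ℝ (Fin 2) →ₗ[ℝ] EuclideanSpace ℝ (Fin 2))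
    (h1 : T (pt2 a₂ 0) = S (pt2 a₂ 0)) (h2 : T (pt2 a₃ b₃) = S (pt2 a₃ b₃))
    (x : EuclideanSpace ℝ (Fin 2)) : T x = S x := by
  have hx : x = ((x 0 - x 1 / b₃ * a₃) / a₂) • pt2 a₂ 0 + (x 1 / b₃) • pt2 a₃ b₃ := by
    ext i; fin_cases i <;> simp [pt2] <;> field_simp
    ring
  rw [hx]
  simp only [map_add, map_smul, h1, h2]

theorem pent_exists (a₂ a₃ b₃ A₂ A₃ B₃ : ℝ)
    (h : (A₂, A₃, B₃) = (-a₂, -a₃, b₃) ∨ (A₂, A₃, B₃) = (a₂, a₃, -b₃)) :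
    ∃ T : EuclideanSpace ℝ (Fin 2) →ₗᵢ[ℝ] EuclideanSpace ℝ (Fin 2),
      T (pt2 a₂ 0) = pt2 A₂ 0 ∧ T (pt2 a₃ b₃) = pt2 A₃ B₃ := by
  simp only [Prod.mk.injEq] at h
  rcases h with ⟨rfl, rfl, rfl⟩ | ⟨rfl, rfl, rfl⟩
  · exact ⟨pentIso (-1) 1 (by norm_num) (by norm_num), by simp [pentIso_apply]⟩
  · exact ⟨pentIso 1 (-1) (by norm_num) (by norm_num), by simp [pentIso_apply]⟩

/-- With `a₂ A₂ b₃ B₃ ≠ 0`, the equations `(B₃−b₃)(A₂−a₂) = 0`,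
`(B₃+b₃)(A₂+a₂) = 0`, `A₃a₂ − A₂a₃ = 0` hold simultaneously iff
`(A₂,A₃,B₃) = (−a₂,−a₃,b₃)` or `(A₂,A₃,B₃) = (a₂,a₃,−b₃)`; in both cases the
linear map sending `(a₂,0) ↦ (A₂,0)` and `(a₃,b₃) ↦ (A₃,B₃)` is an isometry.
Consequently, if the two triangles are not related by a linear isometry, then
the quadratic form `q(e₀,e₃)` is not identically zero. -/
theorem affine_pentapod_translational_orientations
    (a₂ a₃ b₃ A₂ A₃ B₃ : ℝ) (h : a₂ * A₂ * b₃ * B₃ ≠ 0) :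
    (((B₃ - b₃) * (A₂ - a₂) = 0 ∧ (B₃ + b₃) * (A₂ + a₂) = 0 ∧
        A₃ * a₂ - A₂ * a₃ = 0) ↔
      ((A₂, A₃, B₃) = (-a₂, -a₃, b₃) ∨ (A₂, A₃, B₃) = (a₂, a₃, -b₃))) ∧
    (∀ T : E2 →ₗ[ℝ] E2,
      T (pt2 a₂ 0) = pt2 A₂ 0 → T (pt2 a₃ b₃) = pt2 A₃ B₃ →
      ((A₂, A₃, B₃) = (-a₂, -a₃, b₃) ∨ (A₂, A₃, B₃) = (a₂, a₃, -b₃)) →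
      ∀ x : E2, ‖T x‖ = ‖x‖) ∧
    ((¬ ∃ T : E2 →ₗᵢ[ℝ] E2, T (pt2 a₂ 0) = pt2 A₂ 0 ∧ T (pt2 a₃ b₃) = pt2 A₃ B₃) →
      ¬ ∀ e₀ e₃ : ℝ,
        (B₃ - b₃) * (A₂ - a₂) * e₀ ^ 2 + (B₃ + b₃) * (A₂ + a₂) * e₃ ^ 2 +
          2 * (A₃ * a₂ - A₂ * a₃) * e₀ * e₃ = 0) := by
  have ha : a₂ ≠ 0 := by rintro rfl; simp at h
  have hb : b₃ ≠ 0 := by rintro rfl; simp at h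
  refine ⟨pent_algebra a₂ a₃ b₃ A₂ A₃ B₃ h, ?_, ?_⟩
  · intro T h1 h2 hc x
    obtain ⟨S, hS1, hS2⟩ := pent_exists a₂ a₃ b₃ A₂ A₃ B₃ hc
    rw [pent_unique a₂ a₃ b₃ ha hb T S.toLinearMap (h1.trans hS1.symm) (h2.trans hS2.symm) x]
    exact S.norm_map x
  · intro hn hq
    apply hn
    apply pent_exists
    apply (pent_algebra a₂ a₃ b₃ A₂ A₃ B₃ h).1
    have q1 := hq 1 0
    have q2 := hq 0 1
    have q3 := hq 1 1
    refine ⟨by linarith, by linarith, by linarith⟩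

end
end

section
/- Let v, w ∈ ℝ³ and r > 0 satisfy |‖v‖ − ‖w‖| < r < ‖v‖ + ‖w‖. Then there exists an injective continuous map φ from the open unit ball of ℝ² into SO(3) such that ‖φ(x)·v − w‖ = r for every x in the ball. (The set of rotations satisfying a single nondegenerate sphere condition contains a 2-parameter family.) -/
open Metric

noncomputable section

local notation "E2" => EuclideanSpace ℝ (Fin 2)
local notation "E3" => EuclideanSpace ℝ (Fin 3)


lemma aux2 (a b : ℝ) : ∃ c s : ℝ, c ^ 2 + s ^ 2 = 1 ∧ c * a + s * b = √(a ^ 2 + b ^ 2) ∧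
    -s * a + c * b = 0 := by
  by_cases h : a ^ 2 + b ^ 2 = 0
  · have ha : a = 0 := by nlinarith [sq_nonneg a, sq_nonneg b]
    have hb : b = 0 := by nlinarith [sq_nonneg a, sq_nonneg b]
    exact ⟨1, 0, by norm_num, by simp [ha, hb], by simp [ha, hb]⟩
  · have hp : 0 < a ^ 2 + b ^ 2 := lt_of_le_of_ne (by positivity) (Ne.symm h)
    have hs := Real.sq_sqrt hp.le
    have hs0 := Real.sqrt_pos.2 hp
    set q := √(a ^ 2 + b ^ 2)
    refine ⟨a / q, b / q, ?_, ?_, ?_⟩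
    · field_simp; linarith
    · field_simp; linarith
    · field_simp; ring

lemma rotZ_mem (c s : ℝ) (h : c ^ 2 + s ^ 2 = 1) :
    (!![c, s, 0; -s, c, 0; 0, 0, 1] : Matrix (Fin 3) (Fin 3) ℝ) ∈
      Matrix.specialOrthogonalGroup (Fin 3) ℝ := by
  rw [Matrix.mem_specialOrthogonalGroup_iff, Matrix.mem_orthogonalGroup_iff]
  constructor
  · ext i j
    fin_cases i <;> fin_cases j <;>
      simp [Matrix.mul_apply, Fin.sum_univ_three, Matrix.star_eq_conjTranspose] <;> linarith
  · simp [Matrix.det_fin_three]; linarith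

lemma rotX_mem (c s : ℝ) (h : c ^ 2 + s ^ 2 = 1) :
    (!![1, 0, 0; 0, c, -s; 0, s, c] : Matrix (Fin 3) (Fin 3) ℝ) ∈
      Matrix.specialOrthogonalGroup (Fin 3) ℝ := by
  rw [Matrix.mem_specialOrthogonalGroup_iff, Matrix.mem_orthogonalGroup_iff]
  constructor
  · ext i j
    fin_cases i <;> fin_cases j <;>
      simp [Matrix.mul_apply, Fin.sum_univ_three, Matrix.star_eq_conjTranspose] <;> linarith
  · simp [Matrix.det_fin_three]; linarith

lemma align (v : E3) : ∃ A ∈ Matrix.specialOrthogonalGroup (Fin 3) ℝ,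
    A.mulVec v.ofLp = ![0, 0, ‖v‖] := by
  obtain ⟨c, s, h1, h2, h3⟩ := aux2 (v 1) (v 0)
  obtain ⟨c', s', h1', h2', h3'⟩ := aux2 (v 2) (√(v 1 ^ 2 + v 0 ^ 2))
  refine ⟨_, mul_mem (rotX_mem c' s' h1') (rotZ_mem c (-s) (by simpa using h1)), ?_⟩
  rw [← Matrix.mulVec_mulVec]
  have e1 : (!![c, -s, 0; - -s, c, 0; 0, 0, 1] : Matrix (Fin 3) (Fin 3) ℝ).mulVec v.ofLp
      = ![0, √(v 1 ^ 2 + v 0 ^ 2), v 2] := by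
    ext i
    fin_cases i <;> simp [Matrix.mulVec, dotProduct, Fin.sum_univ_three] <;> linarith
  have e2 : ‖v‖ = √(v 2 ^ 2 + √(v 1 ^ 2 + v 0 ^ 2) ^ 2) := by
    rw [EuclideanSpace.norm_eq, Real.sq_sqrt (by positivity)]
    simp only [Fin.sum_univ_three, Real.norm_eq_abs, sq_abs]
    congr 1; ring
  rw [e1, e2, ← h2']
  ext i
  fin_cases i <;> simp [Matrix.mulVec, dotProduct, Fin.sum_univ_three] <;> linarith

def midM (C S s t : ℝ) : Matrix (Fin 3) (Fin 3) ℝ :=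
  !![Real.cos s, Real.sin s, 0; -Real.sin s, Real.cos s, 0; 0, 0, 1] *
    !![1, 0, 0; 0, C, -S; 0, S, C] *
    !![Real.cos t, Real.sin t, 0; -Real.sin t, Real.cos t, 0; 0, 0, 1]

lemma midM_mem (C S s t : ℝ) (h : C ^ 2 + S ^ 2 = 1) :
    midM C S s t ∈ Matrix.specialOrthogonalGroup (Fin 3) ℝ :=
  mul_mem (mul_mem (rotZ_mem _ _ (Real.cos_sq_add_sin_sq s)) (rotX_mem _ _ h))
    (rotZ_mem _ _ (Real.cos_sq_add_sin_sq t))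

lemma midM_cont (C S : ℝ) : Continuous fun x : E2 => midM C S (x 0) (x 1) := by
  unfold midM
  refine continuous_matrix fun i j => ?_
  fin_cases i <;> fin_cases j <;> simp [Matrix.mul_apply, Fin.sum_univ_three] <;> fun_prop

lemma sin_inj_aux {a b : ℝ} (ha : |a| < 1) (hb : |b| < 1) (h : Real.sin a = Real.sin b) :
    a = b := by
  have := Real.pi_gt_three
  rw [abs_lt] at ha hb
  exact Real.injOn_sin ⟨by linarith, by linarith⟩ ⟨by linarith, by linarith⟩ h

lemma coord_lt {x : E2} (hx : x ∈ Metric.ball (0 : E2) 1) (i : Fin 2) : |x i| < 1 := by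
  rw [mem_ball_zero_iff] at hx
  exact lt_of_le_of_lt (by simpa using PiLp.norm_apply_le x i) hx

lemma nsq (v : E3) : v.ofLp ⬝ᵥ v.ofLp = ‖v‖ ^ 2 := by
  rw [EuclideanSpace.norm_sq_eq]
  simp [dotProduct, pow_two]

lemma norm_cond (Q : Matrix (Fin 3) (Fin 3) ℝ) (hQ : Q ∈ Matrix.specialOrthogonalGroup (Fin 3) ℝ)
    (v w : E3) (r : ℝ) (hr : 0 < r)
    (h : 2 * ((Q.mulVec v.ofLp) ⬝ᵥ w.ofLp) = ‖v‖ ^ 2 + ‖w‖ ^ 2 - r ^ 2) :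
    ‖Matrix.toEuclideanLin Q v - w‖ = r := by
  have hQ' := (Matrix.mem_orthogonalGroup_iff' (Fin 3) ℝ).1
    (Matrix.mem_specialOrthogonalGroup_iff.1 hQ).1
  have e : (Q.mulVec v.ofLp) ⬝ᵥ (Q.mulVec v.ofLp) = ‖v‖ ^ 2 := by
    rw [← nsq, Matrix.dotProduct_mulVec, Matrix.vecMul_mulVec]
    change Q.transpose * Q = 1 at hQ'
    rw [← Matrix.mulVec_transpose]
    simp [hQ']
  rw [← sq_eq_sq₀ (norm_nonneg _) hr.le, ← nsq]
  have e3 : (Matrix.toEuclideanLin Q v - w).ofLp = Q.mulVec v.ofLp - w.ofLp := rfl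
  rw [e3, sub_dotProduct, dotProduct_sub, dotProduct_sub, e, nsq,
    dotProduct_comm w.ofLp]
  linarith

/-- The set of rotations `Q ∈ SO(3)` with `‖Q·v − w‖ = r` contains a 2-parameter
family, provided `|‖v‖ − ‖w‖| < r < ‖v‖ + ‖w‖`. -/
theorem two_dim_family_of_rotations_sphere_condition
    (v w : E3) (r : ℝ) (hr : 0 < r)
    (h₁ : |‖v‖ - ‖w‖| < r) (h₂ : r < ‖v‖ + ‖w‖) :
    ∃ φ : E2 → Matrix (Fin 3) (Fin 3) ℝ,
      ContinuousOn φ (Metric.ball 0 1) ∧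
      Set.InjOn φ (Metric.ball 0 1) ∧
      ∀ x ∈ Metric.ball (0 : E2) 1,
        φ x ∈ Matrix.specialOrthogonalGroup (Fin 3) ℝ ∧
        ‖Matrix.toEuclideanLin (φ x) v - w‖ = r := by
  obtain ⟨h1a, h1b⟩ := abs_lt.1 h₁
  have hv0 := norm_nonneg v
  have hw0 := norm_nonneg w
  have hv : 0 < ‖v‖ := by
    rcases hv0.eq_or_lt with h | h
    · linarith
    · exact h
  have hw : 0 < ‖w‖ := by
    rcases hw0.eq_or_lt with h | h
    · linarith
    · exact h
  obtain ⟨A, hA, hAv⟩ := align v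
  obtain ⟨B, hB, hBw⟩ := align w
  set C : ℝ := (‖v‖ ^ 2 + ‖w‖ ^ 2 - r ^ 2) / (2 * ‖v‖ * ‖w‖) with hC
  have hC1 : C < 1 := by
    rw [hC, div_lt_one (by positivity)]; nlinarith
  have hC2 : -1 < C := by
    rw [hC, lt_div_iff₀ (by positivity)]; nlinarith
  have hS2 : 0 < 1 - C ^ 2 := by nlinarith
  set S := √(1 - C ^ 2) with hS
  have hS0 : 0 < S := Real.sqrt_pos.2 hS2
  have hCS : C ^ 2 + S ^ 2 = 1 := by rw [hS, Real.sq_sqrt hS2.le]; ring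
  have hB1 : B * B.transpose = 1 := (Matrix.mem_orthogonalGroup_iff (Fin 3) ℝ).1
    (Matrix.mem_specialOrthogonalGroup_iff.1 hB).1
  have hB2 : B.transpose * B = 1 := (Matrix.mem_orthogonalGroup_iff' (Fin 3) ℝ).1
    (Matrix.mem_specialOrthogonalGroup_iff.1 hB).1
  have hA1 : A * A.transpose = 1 := (Matrix.mem_orthogonalGroup_iff (Fin 3) ℝ).1
    (Matrix.mem_specialOrthogonalGroup_iff.1 hA).1
  have hBt : B.transpose ∈ Matrix.specialOrthogonalGroup (Fin 3) ℝ := by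
    rw [Matrix.mem_specialOrthogonalGroup_iff, Matrix.mem_orthogonalGroup_iff]
    refine ⟨?_, ?_⟩
    · change B.transpose * B.transpose.transpose = 1
      simpa using hB2
    · rw [Matrix.det_transpose]; exact (Matrix.mem_specialOrthogonalGroup_iff.1 hB).2
  refine ⟨fun x => B.transpose * midM C S (x 0) (x 1) * A, ?_, ?_, ?_⟩
  · have := midM_cont C S
    exact Continuous.continuousOn (by fun_prop)
  · intro x hx y hy hxy
    have hM : midM C S (x 0) (x 1) = midM C S (y 0) (y 1) := by
      have key : ∀ M : Matrix (Fin 3) (Fin 3) ℝ,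
          B * (B.transpose * M * A) * A.transpose = M := by
        intro M
        calc _ = (B * B.transpose) * M * (A * A.transpose) := by simp only [Matrix.mul_assoc]
          _ = M := by rw [hB1, hA1]; simp
      rw [← key (midM C S (x 0) (x 1)), ← key (midM C S (y 0) (y 1))]
      exact congrArg (fun N => B * N * A.transpose) hxy
    have h02 := congrFun (congrFun hM 0) 2
    have h20 := congrFun (congrFun hM 2) 0
    simp [midM, Matrix.mul_apply, Fin.sum_univ_three, hS0.ne'] at h02 h20
    have q0 := sin_inj_aux (coord_lt hx 0) (coord_lt hy 0) h02
    have q1 := sin_inj_aux (coord_lt hx 1) (coord_lt hy 1) h20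
    ext i
    fin_cases i
    · exact q0
    · exact q1
  · intro x hx
    have hmem := mul_mem (mul_mem hBt (midM_mem C S (x 0) (x 1) hCS)) hA
    refine ⟨hmem, norm_cond _ hmem v w r hr ?_⟩
    rw [← Matrix.mulVec_mulVec, ← Matrix.mulVec_mulVec, hAv, Matrix.mulVec_transpose,
      ← Matrix.dotProduct_mulVec, hBw]
    have : (midM C S (x 0) (x 1)).mulVec ![0, 0, ‖v‖] ⬝ᵥ ![0, 0, ‖w‖] = C * ‖v‖ * ‖w‖ := by
      simp [midM, Matrix.mulVec, dotProduct, Matrix.mul_apply, Fin.sum_univ_three]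
    rw [this, hC]
    field_simp

end
end

section
/- Let m₁, m₂, m₄, m₅, M₁, M₂, M₃, M ∈ ℝ³ and R₁ > 0 with |‖m₁ − m₂‖ − ‖M₁ − M‖| < R₁ < ‖m₁ − m₂‖ + ‖M₁ − M‖. Consider the pentapod with platform points m₁, m₂, m₃ = m₂, m₄, m₅, base points M₁, M₂, M₃ and M₄ = M₅ = M, and leg lengths R₁, R₂ = ‖M − M₂‖, R₃ = ‖M − M₃‖, and Rⱼ = ‖mⱼ − m₂‖ for j = 4, 5. Then its configuration set contains the image of an injective continuous map from the open unit ball of ℝ²; i.e., the pentapod has a 2-dimensional spherical self-motion, obtained by placing m₂ = m₃ at M₄ = M₅. (Sufficiency part of item 2(a) of Theorem 4.) -/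
open Metric

noncomputable section

local notation "E2" => EuclideanSpace ℝ (Fin 2)
local notation "E3" => EuclideanSpace ℝ (Fin 3)

/-- A pose of the rigid body, acting by `x ↦ Q·x + t`. -/
abbrev Pose := Matrix (Fin 3) (Fin 3) ℝ × EuclideanSpace ℝ (Fin 3)

/-- Configuration set of a pentapod with platform points `m`, base points `M`
and leg lengths `R`. -/
def pentapodConfig (m M : Fin 5 → EuclideanSpace ℝ (Fin 3)) (R : Fin 5 → ℝ) :
    Set Pose :=
  {p | p.1 ∈ Matrix.specialOrthogonalGroup (Fin 3) ℝ ∧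
    ∀ i : Fin 5, ‖Matrix.toEuclideanLin p.1 (m i) + p.2 - M i‖ = R i}

/-- The configuration set contains the image of an injective continuous map
from the open unit ball of `ℝ²`: a 2-dimensional self-motion. -/
def HasTwoDimSelfMotion (K : Set Pose) : Prop :=
  ∃ φ : EuclideanSpace ℝ (Fin 2) → Pose,
    ContinuousOn φ (Metric.ball 0 1) ∧ Set.InjOn φ (Metric.ball 0 1) ∧
    ∀ x ∈ Metric.ball (0 : EuclideanSpace ℝ (Fin 2)) 1, φ x ∈ K



lemma pp_mem_so {A : Matrix (Fin 3) (Fin 3) ℝ} (h : A.transpose * A = 1) (hd : A.det = 1) :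
    A ∈ Matrix.specialOrthogonalGroup (Fin 3) ℝ := by
  rw [Matrix.mem_specialOrthogonalGroup_iff]
  refine ⟨?_, hd⟩
  rw [Matrix.mem_orthogonalGroup_iff']
  exact h

lemma pp_so_tr {A : Matrix (Fin 3) (Fin 3) ℝ} (h : A ∈ Matrix.specialOrthogonalGroup (Fin 3) ℝ) :
    A.transpose * A = 1 ∧ A * A.transpose = 1 ∧
      A.transpose ∈ Matrix.specialOrthogonalGroup (Fin 3) ℝ := by
  rw [Matrix.mem_specialOrthogonalGroup_iff] at h
  obtain ⟨h1, hd⟩ := h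
  have h2 : A.transpose * A = 1 := (Matrix.mem_orthogonalGroup_iff' (Fin 3) ℝ).1 h1
  have h3 : A * A.transpose = 1 := (Matrix.mem_orthogonalGroup_iff (Fin 3) ℝ).1 h1
  refine ⟨h2, h3, pp_mem_so ?_ ?_⟩
  · rw [Matrix.transpose_transpose]; exact h3
  · rw [Matrix.det_transpose]; exact hd

lemma pp_norm {A : Matrix (Fin 3) (Fin 3) ℝ} (h : A ∈ Matrix.specialOrthogonalGroup (Fin 3) ℝ)
    (x : EuclideanSpace ℝ (Fin 3)) : ‖Matrix.toEuclideanLin A x‖ = ‖x‖ := by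
  have h2 := (pp_so_tr h).1
  have key : ∀ y : EuclideanSpace ℝ (Fin 3), ‖y‖ ^ 2 = y.ofLp ⬝ᵥ y.ofLp := by
    intro y
    rw [EuclideanSpace.real_norm_sq_eq]
    simp [dotProduct, sq]
  rw [← sq_eq_sq₀ (norm_nonneg _) (norm_nonneg _), key, key]
  change (A.mulVec x.ofLp) ⬝ᵥ (A.mulVec x.ofLp) = _
  rw [Matrix.dotProduct_mulVec, ← Matrix.mulVec_transpose, Matrix.mulVec_mulVec, h2,
    Matrix.one_mulVec]

lemma pp_mul (A B : Matrix (Fin 3) (Fin 3) ℝ) (x : EuclideanSpace ℝ (Fin 3)) :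
    Matrix.toEuclideanLin (A * B) x = Matrix.toEuclideanLin A (Matrix.toEuclideanLin B x) := by
  ext i
  change ((A * B).mulVec x.ofLp) i = (A.mulVec (B.mulVec x.ofLp)) i
  rw [Matrix.mulVec_mulVec]

lemma pp_exists (v : EuclideanSpace ℝ (Fin 3)) :
    ∃ A ∈ Matrix.specialOrthogonalGroup (Fin 3) ℝ,
      v = Matrix.toEuclideanLin A (!₂[0, 0, ‖v‖]) := by
  have polar : ∀ a b : ℝ, ∃ r p q : ℝ, a = r * p ∧ b = r * q ∧ p ^ 2 + q ^ 2 = 1 ∧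
      r ^ 2 = a ^ 2 + b ^ 2 ∧ 0 ≤ r := by
    intro a b
    by_cases h0 : a ^ 2 + b ^ 2 = 0
    · have ha : a = 0 := by nlinarith [sq_nonneg a, sq_nonneg b]
      have hb : b = 0 := by nlinarith [sq_nonneg a, sq_nonneg b]
      exact ⟨0, 1, 0, by simp [ha], by simp [hb], by norm_num, by simp [ha, hb], le_rfl⟩
    · have hs := Real.sq_sqrt (by positivity : 0 ≤ a ^ 2 + b ^ 2)
      have hn : √(a ^ 2 + b ^ 2) ≠ 0 := by
        intro h; rw [h] at hs; apply h0; linarith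
      refine ⟨√(a ^ 2 + b ^ 2), a / √(a ^ 2 + b ^ 2), b / √(a ^ 2 + b ^ 2), ?_, ?_, ?_, hs,
        Real.sqrt_nonneg _⟩
      · field_simp
      · field_simp
      · rw [div_pow, div_pow, ← add_div, hs, div_self h0]
  obtain ⟨r, p, q, h1, h2, h3, h4, -⟩ := polar (v 0) (v 1)
  obtain ⟨n, s, z, h5, h6, h7, h8, h9⟩ := polar r (v 2)
  have hn : n = ‖v‖ := by
    rw [← sq_eq_sq₀ h9 (norm_nonneg _), EuclideanSpace.real_norm_sq_eq, Fin.sum_univ_three, h8, h4]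
  rw [← hn]
  refine ⟨!![p * z, -q, s * p; q * z, p, s * q; -s, 0, z], pp_mem_so ?_ ?_, ?_⟩
  · ext i j
    fin_cases i <;> fin_cases j <;>
      simp [Matrix.mul_apply, Fin.sum_univ_three] <;> grind
  · rw [Matrix.det_fin_three]; simp; grind
  · ext i
    change v i = (Matrix.mulVec !![p * z, -q, s * p; q * z, p, s * q; -s, 0, z] ![0, 0, n]) i
    fin_cases i <;> simp [Matrix.mulVec, dotProduct, Fin.sum_univ_three] <;> grind

/-- `Rz(s) Rx(θ) Rz(u)` -/
def ppN (c d s u : ℝ) : Matrix (Fin 3) (Fin 3) ℝ :=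
  !![Real.cos s, -Real.sin s, 0; Real.sin s, Real.cos s, 0; 0, 0, 1] *
    (!![1, 0, 0; 0, c, -d; 0, d, c] *
      !![Real.cos u, -Real.sin u, 0; Real.sin u, Real.cos u, 0; 0, 0, 1])

lemma pp_rz (s : ℝ) : !![Real.cos s, -Real.sin s, 0; Real.sin s, Real.cos s, 0; 0, 0, 1] ∈
    Matrix.specialOrthogonalGroup (Fin 3) ℝ := by
  have := Real.sin_sq_add_cos_sq s
  refine pp_mem_so ?_ ?_
  · ext i j
    fin_cases i <;> fin_cases j <;>
      simp [Matrix.mul_apply, Fin.sum_univ_three] <;> grind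
  · rw [Matrix.det_fin_three]; simp; grind

lemma ppN_mem {c d : ℝ} (h : c ^ 2 + d ^ 2 = 1) (s u : ℝ) :
    ppN c d s u ∈ Matrix.specialOrthogonalGroup (Fin 3) ℝ := by
  refine mul_mem (pp_rz s) (mul_mem (pp_mem_so ?_ ?_) (pp_rz u))
  · ext i j
    fin_cases i <;> fin_cases j <;>
      simp [Matrix.mul_apply, Fin.sum_univ_three] <;> grind
  · rw [Matrix.det_fin_three]; simp; grind

lemma ppN_cont (c d : ℝ) : Continuous fun x : EuclideanSpace ℝ (Fin 2) => ppN c d (x 0) (x 1) := by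
  have h : ∀ k : Fin 2, Continuous fun x : EuclideanSpace ℝ (Fin 2) =>
      (!![Real.cos (x k), -Real.sin (x k), 0; Real.sin (x k), Real.cos (x k), 0; 0, 0, 1] :
        Matrix (Fin 3) (Fin 3) ℝ) := by
    intro k
    refine continuous_matrix fun i j => ?_
    fin_cases i <;> fin_cases j <;> simp <;> fun_prop
  exact (h 0).matrix_mul (continuous_const.matrix_mul (h 1))

lemma pp_abs {x : EuclideanSpace ℝ (Fin 2)} (hx : x ∈ Metric.ball (0 : EuclideanSpace ℝ (Fin 2)) 1)
    (k : Fin 2) : x k ∈ Set.Icc (-(Real.pi / 2)) (Real.pi / 2) := by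
  have h1 : ‖x k‖ ≤ ‖x‖ := PiLp.norm_apply_le x k
  have h2 : ‖x‖ < 1 := by simpa using hx
  rw [Real.norm_eq_abs] at h1
  have := abs_le.1 (h1.trans h2.le)
  have := Real.pi_gt_three
  constructor <;> linarith

theorem pentapod_item2a_thm4
    (m₁ m₂ m₄ m₅ M₁ M₂ M₃ M : E3) (R₁ : ℝ) (hR₁ : 0 < R₁)
    (h₁ : |‖m₁ - m₂‖ - ‖M₁ - M‖| < R₁)
    (h₂ : R₁ < ‖m₁ - m₂‖ + ‖M₁ - M‖) :
    HasTwoDimSelfMotion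
      (pentapodConfig ![m₁, m₂, m₂, m₄, m₅] ![M₁, M₂, M₃, M, M]
        ![R₁, ‖M - M₂‖, ‖M - M₃‖, ‖m₄ - m₂‖, ‖m₅ - m₂‖]) := by
  obtain ⟨A, hA, hAv⟩ := pp_exists (m₁ - m₂)
  obtain ⟨B, hB, hBv⟩ := pp_exists (M₁ - M)
  generalize ‖m₁ - m₂‖ = α at h₁ h₂ hAv
  generalize ‖M₁ - M‖ = β at h₁ h₂ hBv
  obtain ⟨h3, h4⟩ := abs_lt.1 h₁
  have hα : 0 < α := by linarith
  have hβ : 0 < β := by linarith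
  obtain ⟨c, hc⟩ : ∃ c, α * β * c = (α ^ 2 + β ^ 2 - R₁ ^ 2) / 2 :=
    ⟨(α ^ 2 + β ^ 2 - R₁ ^ 2) / 2 / (α * β), by field_simp⟩
  have hc1 : c < 1 := by
    by_contra! h
    have : α * β * 1 ≤ α * β * c := by gcongr
    nlinarith
  have hc2 : -1 < c := by
    by_contra! h
    have : α * β * c ≤ α * β * (-1) := by gcongr
    nlinarith
  have hpos : 0 < 1 - c ^ 2 := by nlinarith
  obtain ⟨d, hd0, hcd⟩ : ∃ d, d ≠ 0 ∧ c ^ 2 + d ^ 2 = 1 :=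
    ⟨√(1 - c ^ 2), (Real.sqrt_pos.2 hpos).ne', by rw [Real.sq_sqrt hpos.le]; ring⟩
  obtain ⟨hA1, hA2, hA3⟩ := pp_so_tr hA
  obtain ⟨hB1, hB2, hB3⟩ := pp_so_tr hB
  have hQc : Continuous fun x : EuclideanSpace ℝ (Fin 2) =>
      B * (ppN c d (x 0) (x 1) * A.transpose) :=
    continuous_const.matrix_mul ((ppN_cont c d).matrix_mul continuous_const)
  refine ⟨fun x => (B * (ppN c d (x 0) (x 1) * A.transpose),
    M - Matrix.toEuclideanLin (B * (ppN c d (x 0) (x 1) * A.transpose)) m₂), ?_, ?_, ?_⟩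
  · refine (hQc.prodMk (continuous_const.sub ?_)).continuousOn
    exact (PiLp.continuous_toLp 2 _).comp (hQc.matrix_mulVec continuous_const)
  · intro x hx y hy hxy
    have h := (Prod.mk.inj hxy).1
    have h' : ppN c d (x 0) (x 1) = ppN c d (y 0) (y 1) := by
      have hk : ∀ N : Matrix (Fin 3) (Fin 3) ℝ,
          B.transpose * (B * (N * A.transpose)) * A = N := by
        intro N
        rw [← mul_assoc, hB1, one_mul, mul_assoc, hA1, mul_one]
      rw [← hk (ppN c d (x 0) (x 1)), h, hk]
    have e0 := congrFun (congrFun h' 0) 2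
    have e1 := congrFun (congrFun h' 2) 0
    simp [ppN, Matrix.mul_apply, Fin.sum_univ_three, hd0] at e0 e1
    ext k
    fin_cases k
    · exact Real.injOn_sin (pp_abs hx 0) (pp_abs hy 0) e0
    · exact Real.injOn_sin (pp_abs hx 1) (pp_abs hy 1) e1
  · intro x hx
    have hN := ppN_mem hcd (x 0) (x 1)
    have hQ := mul_mem hB (mul_mem hN hA3)
    have hgen : ∀ m P : EuclideanSpace ℝ (Fin 3), ∀ Q : Matrix (Fin 3) (Fin 3) ℝ,
        Matrix.toEuclideanLin Q m + (M - Matrix.toEuclideanLin Q m₂) - P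
          = Matrix.toEuclideanLin Q (m - m₂) - (P - M) := by
      intro m P Q
      rw [map_sub]; abel
    refine ⟨hQ, fun i => ?_⟩
    dsimp only
    rw [hgen]
    fin_cases i
    · change ‖Matrix.toEuclideanLin _ (m₁ - m₂) - (M₁ - M)‖ = R₁
      have hAA : Matrix.toEuclideanLin A.transpose (m₁ - m₂) = !₂[0, 0, α] := by
        rw [hAv, ← pp_mul, hA1]
        ext i
        change (Matrix.mulVec (1 : Matrix (Fin 3) (Fin 3) ℝ) ![0, 0, α]) i = _
        rw [Matrix.one_mulVec]
      rw [pp_mul, pp_mul, hAA, hBv, ← map_sub, pp_norm hB,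
        ← sq_eq_sq₀ (norm_nonneg _) hR₁.le, EuclideanSpace.real_norm_sq_eq, Fin.sum_univ_three]
      have hv : ∀ i, (Matrix.toEuclideanLin (ppN c d (x 0) (x 1)) !₂[0, 0, α]) i
          = ppN c d (x 0) (x 1) i 2 * α := by
        intro i
        change (Matrix.mulVec (ppN c d (x 0) (x 1)) ![0, 0, α]) i = _
        simp [Matrix.mulVec, dotProduct, Fin.sum_univ_three]
      simp only [PiLp.sub_apply, hv]
      have := Real.sin_sq_add_cos_sq (x 0)
      simp [ppN, Matrix.mul_apply, Fin.sum_univ_three]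
      linear_combination d ^ 2 * α ^ 2 * this + α ^ 2 * hcd - 2 * hc
    · change ‖Matrix.toEuclideanLin _ (m₂ - m₂) - (M₂ - M)‖ = ‖M - M₂‖
      simp
    · change ‖Matrix.toEuclideanLin _ (m₂ - m₂) - (M₃ - M)‖ = ‖M - M₃‖
      simp
    · change ‖Matrix.toEuclideanLin _ (m₄ - m₂) - (M - M)‖ = ‖m₄ - m₂‖
      rw [sub_self, sub_zero, pp_norm hQ]
    · change ‖Matrix.toEuclideanLin _ (m₅ - m₂) - (M - M)‖ = ‖m₅ - m₂‖
      rw [sub_self, sub_zero, pp_norm hQ]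

end
end

section
/- Let e, f ∈ ℝ³ be unit vectors, c ∈ (−1, 1), λ₂, λ₃, λ₄, μ₂, μ₃, μ₄ ∈ ℝ, and let m₁, m₅, M₁, M₅ ∈ ℝ³. Consider the pentapod with platform points m₁, mᵢ = m₁ + λᵢ·e for i = 2, 3, 4 (so m₁, m₂, m₃, m₄ are collinear) and m₅, base points M₁, Mᵢ = M₅ + μᵢ·f for i = 2, 3, 4 and M₅ (so M₂, M₃, M₄, M₅ are collinear), and leg lengths R₁ = ‖M₅ − M₁‖, Rᵢ = √(λᵢ² + μᵢ² − 2·λᵢ·μᵢ·c) for i = 2, 3, 4, and R₅ = ‖m₅ − m₁‖. Then its configuration set contains the image of an injective continuous map from the open unit ball of ℝ²; i.e., the pentapod has a 2-dimensional spherical self-motion, obtained by placing m₁ at M₅. (Sufficiency part of item 3 of Theorem 4.) -/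
open Metric

noncomputable section

local notation "E2" => EuclideanSpace ℝ (Fin 2)
local notation "E3" => EuclideanSpace ℝ (Fin 3)

lemma exists_rot (f : Fin 3 → ℝ) (hf : f 0 ^ 2 + f 1 ^ 2 + f 2 ^ 2 = 1) :
    ∃ A : Matrix (Fin 3) (Fin 3) ℝ, A ∈ Matrix.specialOrthogonalGroup (Fin 3) ℝ ∧
      A.mulVec ![1, 0, 0] = f := by
  by_cases hk : 1 + f 0 = 0
  · have h0 : f 0 = -1 := by linarith
    have h1 : f 1 = 0 := by
      rw [h0] at hf; nlinarith [sq_nonneg (f 1), sq_nonneg (f 2)]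
    have h2 : f 2 = 0 := by
      rw [h0] at hf; nlinarith [sq_nonneg (f 1), sq_nonneg (f 2)]
    refine ⟨!![-1, 0, 0; 0, -1, 0; 0, 0, 1], ?_, ?_⟩
    · rw [Matrix.mem_specialOrthogonalGroup_iff, Matrix.mem_orthogonalGroup_iff]
      refine ⟨?_, by simp [Matrix.det_fin_three]⟩
      ext i j
      fin_cases i <;> fin_cases j <;> simp [Matrix.mul_apply, Fin.sum_univ_three]
    · ext i
      fin_cases i <;> simp [Matrix.mulVec, dotProduct, Fin.sum_univ_three, h0, h1, h2]
  · generalize hp : f 0 = p at *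
    generalize hq : f 1 = q at *
    generalize hr : f 2 = r at *
    have hr2 : r ^ 2 = 1 - p ^ 2 - q ^ 2 := by linarith
    obtain ⟨k, hkk⟩ : ∃ k, k = (1 + p)⁻¹ := ⟨_, rfl⟩
    have hk1 : k * (1 + p) = 1 := by rw [hkk]; exact inv_mul_cancel₀ hk
    have hk2 : k * (q ^ 2 + r ^ 2) = 1 - p := by linear_combination k * hf + (1 - p) * hk1
    refine ⟨!![p, -q, -r; q, 1 - q * q * k, -q * r * k; r, -q * r * k, 1 - r * r * k], ?_, ?_⟩
    · rw [Matrix.mem_specialOrthogonalGroup_iff, Matrix.mem_orthogonalGroup_iff]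
      refine ⟨?_, ?_⟩
      · ext i j
        fin_cases i <;> fin_cases j <;> simp [Matrix.mul_apply, Fin.sum_univ_three] <;> grind
      · simp [Matrix.det_fin_three]
        grind
    · ext i
      fin_cases i <;> simp [Matrix.mulVec, dotProduct, Fin.sum_univ_three, hp, hq, hr]

/-- rotation about the first axis -/
def rotX (a b : ℝ) : Matrix (Fin 3) (Fin 3) ℝ := !![1, 0, 0; 0, b, -a; 0, a, b]

/-- rotation about the third axis -/
def rotZ (a b : ℝ) : Matrix (Fin 3) (Fin 3) ℝ := !![b, -a, 0; a, b, 0; 0, 0, 1]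

lemma rotX_mem_s13 {a b : ℝ} (h : a ^ 2 + b ^ 2 = 1) :
    rotX a b ∈ Matrix.specialOrthogonalGroup (Fin 3) ℝ := by
  rw [Matrix.mem_specialOrthogonalGroup_iff, Matrix.mem_orthogonalGroup_iff]
  refine ⟨?_, ?_⟩
  · ext i j
    fin_cases i <;> fin_cases j <;> simp [rotX, Matrix.mul_apply, Fin.sum_univ_three] <;>
      linarith
  · simp [rotX, Matrix.det_fin_three]; linarith

lemma rotZ_mem_s13 {a b : ℝ} (h : a ^ 2 + b ^ 2 = 1) :
    rotZ a b ∈ Matrix.specialOrthogonalGroup (Fin 3) ℝ := by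
  rw [Matrix.mem_specialOrthogonalGroup_iff, Matrix.mem_orthogonalGroup_iff]
  refine ⟨?_, ?_⟩
  · ext i j
    fin_cases i <;> fin_cases j <;> simp [rotZ, Matrix.mul_apply, Fin.sum_univ_three] <;>
      linarith
  · simp [rotZ, Matrix.det_fin_three]; linarith

lemma so_tmul {A : Matrix (Fin 3) (Fin 3) ℝ}
    (h : A ∈ Matrix.specialOrthogonalGroup (Fin 3) ℝ) : A.transpose * A = 1 := by
  rw [Matrix.mem_specialOrthogonalGroup_iff, Matrix.mem_orthogonalGroup_iff'] at h
  exact h.1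

lemma so_transpose {A : Matrix (Fin 3) (Fin 3) ℝ}
    (h : A ∈ Matrix.specialOrthogonalGroup (Fin 3) ℝ) :
    A.transpose ∈ Matrix.specialOrthogonalGroup (Fin 3) ℝ := by
  have h' := h
  rw [Matrix.mem_specialOrthogonalGroup_iff] at h' ⊢
  refine ⟨?_, by rw [Matrix.det_transpose]; exact h'.2⟩
  rw [Matrix.mem_orthogonalGroup_iff]
  simpa [Matrix.star_eq_conjTranspose] using so_tmul h

lemma so_dot {A : Matrix (Fin 3) (Fin 3) ℝ}
    (h : A ∈ Matrix.specialOrthogonalGroup (Fin 3) ℝ) (v w : Fin 3 → ℝ) :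
    dotProduct (A.mulVec v) (A.mulVec w) = dotProduct v w := by
  rw [Matrix.dotProduct_mulVec, Matrix.vecMul_mulVec, so_tmul h]; simp

lemma norm_sq_dot (v : E3) : ‖v‖ ^ 2 = dotProduct v.ofLp v.ofLp := by
  rw [EuclideanSpace.norm_sq_eq]; simp [dotProduct, pow_two]

lemma so_norm {A : Matrix (Fin 3) (Fin 3) ℝ}
    (h : A ∈ Matrix.specialOrthogonalGroup (Fin 3) ℝ) (v : E3) :
    ‖Matrix.toEuclideanLin A v‖ = ‖v‖ := by
  have : ‖Matrix.toEuclideanLin A v‖ ^ 2 = ‖v‖ ^ 2 := by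
    rw [norm_sq_dot, norm_sq_dot]; exact so_dot h _ _
  exact (sq_eq_sq₀ (norm_nonneg _) (norm_nonneg _)).1 this

/-- the middle part of the rotation -/
def midW (c d : ℝ) (x : E2) : Matrix (Fin 3) (Fin 3) ℝ :=
  rotX (x 0) (Real.sqrt (1 - x 0 ^ 2)) * rotZ d c * rotX (x 1) (Real.sqrt (1 - x 1 ^ 2))

lemma midW_cont (c d : ℝ) : Continuous (midW c d) := by
  unfold midW rotX
  refine Continuous.matrix_mul (Continuous.matrix_mul ?_ continuous_const) ?_ <;>
  · refine continuous_matrix fun i j => ?_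
    fin_cases i <;> fin_cases j <;> simp <;> fun_prop

lemma leg (Q : Matrix (Fin 3) (Fin 3) ℝ)
    (hQ : Q ∈ Matrix.specialOrthogonalGroup (Fin 3) ℝ) (e f m M : E3) (c l u : ℝ)
    (he : ‖e‖ = 1) (hf : ‖f‖ = 1)
    (h : dotProduct (Q.mulVec e.ofLp) f.ofLp = c) :
    ‖Matrix.toEuclideanLin Q (m + l • e) + (M - Matrix.toEuclideanLin Q m) - (M + u • f)‖
      = Real.sqrt (l ^ 2 + u ^ 2 - 2 * l * u * c) := by
  have h1 : Matrix.toEuclideanLin Q (m + l • e) + (M - Matrix.toEuclideanLin Q m) - (M + u • f)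
      = l • Matrix.toEuclideanLin Q e - u • f := by
    rw [map_add, map_smul]; abel
  have h3 : inner ℝ (Matrix.toEuclideanLin Q e) f = c := by
    rw [← h, EuclideanSpace.inner_eq_star_dotProduct, dotProduct_comm]; rfl
  have h4 : ‖l • Matrix.toEuclideanLin Q e - u • f‖ ^ 2 = l ^ 2 + u ^ 2 - 2 * l * u * c := by
    rw [norm_sub_sq_real, norm_smul, norm_smul, so_norm hQ, he, hf, inner_smul_left,
      inner_smul_right, h3]
    simp; ring
  rw [h1, ← h4, Real.sqrt_sq (norm_nonneg _)]

/-- Sufficiency part of item 3 of Theorem 4: a pentapod with collinear platform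
points `m₁, m₂, m₃, m₄`, collinear base points `M₂, M₃, M₄, M₅` and the stated
leg lengths has a 2-dimensional spherical self-motion, obtained by placing `m₁`
at `M₅`. -/
theorem pentapod_item3_thm4
    (e f : E3) (he : ‖e‖ = 1) (hf : ‖f‖ = 1)
    (c : ℝ) (hc : c ∈ Set.Ioo (-1 : ℝ) 1)
    (lam₂ lam₃ lam₄ mu₂ mu₃ mu₄ : ℝ) (m₁ m₅ M₁ M₅ : E3) :
    HasTwoDimSelfMotion
      (pentapodConfig
        ![m₁, m₁ + lam₂ • e, m₁ + lam₃ • e, m₁ + lam₄ • e, m₅]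
        ![M₁, M₅ + mu₂ • f, M₅ + mu₃ • f, M₅ + mu₄ • f, M₅]
        ![‖M₅ - M₁‖,
          Real.sqrt (lam₂ ^ 2 + mu₂ ^ 2 - 2 * lam₂ * mu₂ * c),
          Real.sqrt (lam₃ ^ 2 + mu₃ ^ 2 - 2 * lam₃ * mu₃ * c),
          Real.sqrt (lam₄ ^ 2 + mu₄ ^ 2 - 2 * lam₄ * mu₄ * c),
          ‖m₅ - m₁‖]) := by
  obtain ⟨B, hB, hBe⟩ := exists_rot e.ofLp (by
    have := norm_sq_dot e; rw [he] at this
    simp [dotProduct, Fin.sum_univ_three] at this; linarith)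
  obtain ⟨A, hA, hAf⟩ := exists_rot f.ofLp (by
    have := norm_sq_dot f; rw [hf] at this
    simp [dotProduct, Fin.sum_univ_three] at this; linarith)
  obtain ⟨d, hd, hdc⟩ : ∃ d : ℝ, 0 < d ∧ d ^ 2 + c ^ 2 = 1 := by
    have : 0 < 1 - c ^ 2 := by nlinarith [hc.1, hc.2]
    exact ⟨Real.sqrt (1 - c ^ 2), Real.sqrt_pos.2 this, by rw [Real.sq_sqrt this.le]; ring⟩
  have hcont : Continuous fun x : E2 => A * midW c d x * B.transpose :=
    (continuous_const.matrix_mul (midW_cont c d)).matrix_mul continuous_const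
  refine ⟨fun x => (A * midW c d x * B.transpose,
    M₅ - Matrix.toEuclideanLin (A * midW c d x * B.transpose) m₁), ?_, ?_, ?_⟩
  · refine Continuous.continuousOn (hcont.prodMk (continuous_const.sub ?_))
    exact (PiLp.continuous_toLp 2 _).comp (hcont.matrix_mulVec continuous_const)
  · intro x _ y _ hxy
    have h1 : A * midW c d x * B.transpose = A * midW c d y * B.transpose :=
      congrArg Prod.fst hxy
    have h2 : midW c d x = midW c d y := by
      have := congrArg (fun Z => A.transpose * Z * B) h1
      simpa only [Matrix.mul_assoc, so_tmul hB, Matrix.mul_one, ← Matrix.mul_assoc A.transpose A,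
        so_tmul hA, Matrix.one_mul] using this
    have h20 := congrFun (congrFun h2 2) 0
    have h02 := congrFun (congrFun h2 0) 2
    simp [midW, rotX, rotZ, Matrix.mul_apply, Fin.sum_univ_three, hd.ne'] at h20 h02
    ext i
    fin_cases i
    · exact h20
    · exact h02
  · intro x hx
    have hn : x 0 ^ 2 + x 1 ^ 2 < 1 := by
      have h := EuclideanSpace.norm_sq_eq x
      have h' : ‖x‖ < 1 := by simpa using hx
      simp [Fin.sum_univ_two] at h
      nlinarith [norm_nonneg x]
    have hW : midW c d x ∈ Matrix.specialOrthogonalGroup (Fin 3) ℝ := by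
      refine mul_mem (mul_mem (rotX_mem_s13 ?_) (rotZ_mem_s13 hdc)) (rotX_mem_s13 ?_)
      · rw [Real.sq_sqrt (by nlinarith [sq_nonneg (x 1)])]; ring
      · rw [Real.sq_sqrt (by nlinarith [sq_nonneg (x 0)])]; ring
    have hQ := mul_mem (mul_mem hA hW) (so_transpose hB)
    have hdot : dotProduct ((A * midW c d x * B.transpose).mulVec e.ofLp) f.ofLp = c := by
      rw [← hBe, ← hAf, Matrix.mulVec_mulVec, Matrix.mul_assoc, so_tmul hB, Matrix.mul_one,
        ← Matrix.mulVec_mulVec, so_dot hA]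
      simp [midW, rotX, rotZ, Matrix.mul_apply, Fin.sum_univ_three, Matrix.mulVec, dotProduct]
    refine ⟨hQ, fun i => ?_⟩
    fin_cases i
    · change ‖_ + (M₅ - _) - M₁‖ = ‖M₅ - M₁‖
      congr 1
      exact congrArg (· - M₁) (add_sub_cancel _ _)
    · exact leg _ hQ e f m₁ M₅ c lam₂ mu₂ he hf hdot
    · exact leg _ hQ e f m₁ M₅ c lam₃ mu₃ he hf hdot
    · exact leg _ hQ e f m₁ M₅ c lam₄ mu₄ he hf hdot
    · change ‖Matrix.toEuclideanLin (A * midW c d x * B.transpose) m₅ +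
        (M₅ - Matrix.toEuclideanLin (A * midW c d x * B.transpose) m₁) - M₅‖ = ‖m₅ - m₁‖
      rw [← so_norm hQ (m₅ - m₁), map_sub]
      congr 1
      abel

end
end

section
/- Let e, f ∈ ℝ³ be unit vectors, c ∈ (−1, 1), λ₂, λ₃, λ₄, λ₅, μ₂, μ₃, μ₄, μ₅ ∈ ℝ, and let m₁, m₆, M₁, M₆ ∈ ℝ³. Consider the hexapod with platform points m₁, mᵢ = m₁ + λᵢ·e for i = 2,…,5 (so m₁,…,m₅ are collinear) and m₆, base points M₁, Mᵢ = M₆ + μᵢ·f for i = 2,…,5 and M₆ (so M₂,…,M₆ are collinear), and leg lengths R₁ = ‖M₆ − M₁‖, Rᵢ = √(λᵢ² + μᵢ² − 2·λᵢ·μᵢ·c) for i = 2,…,5, and R₆ = ‖m₆ − m₁‖. Then its configuration set contains the image of an injective continuous map from the open unit ball of ℝ²; i.e., the hexapod has a 2-dimensional spherical self-motion, obtained by placing m₁ at M₆. (Sufficiency part of item 2 of Theorem 6.) -/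
open Metric

noncomputable section

local notation "E2" => EuclideanSpace ℝ (Fin 2)
local notation "E3" => EuclideanSpace ℝ (Fin 3)

/-- Configuration set of a hexapod with platform points `m`, base points `M`
and leg lengths `R`. -/
def hexapodConfig (m M : Fin 6 → EuclideanSpace ℝ (Fin 3)) (R : Fin 6 → ℝ) :
    Set Pose :=
  {p | p.1 ∈ Matrix.specialOrthogonalGroup (Fin 3) ℝ ∧
    ∀ i : Fin 6, ‖Matrix.toEuclideanLin p.1 (m i) + p.2 - M i‖ = R i}

theorem hx_frame (a b d : ℝ) (h : a ^ 2 + b ^ 2 + d ^ 2 = 1) :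
    ∃ A : Matrix (Fin 3) (Fin 3) ℝ, A ∈ Matrix.specialOrthogonalGroup (Fin 3) ℝ ∧
      A.mulVec ![0, 0, 1] = ![a, b, d] := by
  by_cases hr : a ^ 2 + b ^ 2 = 0
  · have ha : a = 0 := by nlinarith [sq_nonneg a, sq_nonneg b]
    have hb : b = 0 := by nlinarith [sq_nonneg a, sq_nonneg b]
    subst ha hb
    have hd : d * d = 1 := by nlinarith
    refine ⟨!![1, 0, 0; 0, d, 0; 0, 0, d], ?_, ?_⟩
    · rw [Matrix.mem_specialOrthogonalGroup_iff, Matrix.mem_orthogonalGroup_iff]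
      constructor
      · ext i j
        fin_cases i <;> fin_cases j <;>
          simp [Matrix.mul_apply, Fin.sum_univ_three, Matrix.star_eq_conjTranspose, hd]
      · simp [Matrix.det_fin_three, hd]
    · ext i
      fin_cases i <;> simp [Matrix.mulVec, dotProduct, Fin.sum_univ_three]
  · have hpos : 0 < a ^ 2 + b ^ 2 := lt_of_le_of_ne (by positivity) (Ne.symm hr)
    obtain ⟨k, hk⟩ : ∃ k : ℝ, k ^ 2 * (a ^ 2 + b ^ 2) = 1 := by
      refine ⟨(Real.sqrt (a ^ 2 + b ^ 2))⁻¹, ?_⟩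
      rw [inv_pow, Real.sq_sqrt hpos.le, inv_mul_cancel₀ hr]
    refine ⟨!![-b * k, -d * a * k, a; a * k, -d * b * k, b;
      0, (a ^ 2 + b ^ 2) * k, d], ?_, ?_⟩
    · rw [Matrix.mem_specialOrthogonalGroup_iff, Matrix.mem_orthogonalGroup_iff']
      constructor
      · ext i j
        fin_cases i <;> fin_cases j <;>
          simp [Matrix.mul_apply, Fin.sum_univ_three, Matrix.star_eq_conjTranspose]
        · linear_combination hk
        · ring
        · ring
        · ring
        · linear_combination (d ^ 2 + a ^ 2 + b ^ 2) * hk + h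
        · ring
        · ring
        · ring
        · linear_combination h
      · simp [Matrix.det_fin_three]
        linear_combination (d ^ 2 + a ^ 2 + b ^ 2) * hk + h
    · ext i
      fin_cases i <;> simp [Matrix.mulVec, dotProduct, Fin.sum_univ_three]

theorem hx_frame' (e : EuclideanSpace ℝ (Fin 3)) (he : ‖e‖ = 1) :
    ∃ A : Matrix (Fin 3) (Fin 3) ℝ, A ∈ Matrix.specialOrthogonalGroup (Fin 3) ℝ ∧
      Matrix.toEuclideanLin A (!₂[0, 0, 1]) = e := by
  have h : e 0 ^ 2 + e 1 ^ 2 + e 2 ^ 2 = 1 := by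
    have := EuclideanSpace.real_norm_sq_eq e
    rw [he, Fin.sum_univ_three] at this
    linarith
  obtain ⟨A, hA, hAe⟩ := hx_frame _ _ _ h
  refine ⟨A, hA, ?_⟩
  rw [Matrix.toLpLin_toLp, Matrix.toLin'_apply, hAe]
  ext i
  fin_cases i <;> simp

theorem hx_norm (A : Matrix (Fin 3) (Fin 3) ℝ) (hA : A ∈ Matrix.specialOrthogonalGroup (Fin 3) ℝ)
    (v : EuclideanSpace ℝ (Fin 3)) : ‖Matrix.toEuclideanLin A v‖ = ‖v‖ := by
  rw [Matrix.mem_specialOrthogonalGroup_iff, Matrix.mem_orthogonalGroup_iff'] at hA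
  have h1 := hA.1
  rw [← sq_eq_sq₀ (norm_nonneg _) (norm_nonneg _), ← real_inner_self_eq_norm_sq,
    ← real_inner_self_eq_norm_sq]
  simp only [EuclideanSpace.inner_eq_star_dotProduct, Matrix.ofLp_toLpLin, Matrix.toLin'_apply,
    star_trivial]
  rw [Matrix.dotProduct_mulVec, Matrix.vecMul_mulVec]
  have h2 : A.transpose * A = 1 := by
    simpa [Matrix.star_eq_conjTranspose] using h1
  rw [h2]
  simp

def hxZ (c s p x q y : ℝ) : Matrix (Fin 3) (Fin 3) ℝ :=
  !![p * c * q - x * y, -p * c * y - x * q, p * s;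
     x * c * q + p * y, -x * c * y + p * q, x * s;
     -s * q, s * y, c]

theorem hxZ_mem (c s p x q y : ℝ) (h1 : c ^ 2 + s ^ 2 = 1) (h2 : p ^ 2 + x ^ 2 = 1)
    (h3 : q ^ 2 + y ^ 2 = 1) : hxZ c s p x q y ∈ Matrix.specialOrthogonalGroup (Fin 3) ℝ := by
  have e : hxZ c s p x q y = !![p, -x, 0; x, p, 0; 0, 0, 1] * (!![c, 0, s; 0, 1, 0; -s, 0, c] *
      !![q, -y, 0; y, q, 0; 0, 0, 1]) := by
    ext i j
    fin_cases i <;> fin_cases j <;>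
      simp [hxZ, Matrix.mul_apply, Fin.sum_univ_three] <;> ring
  have hz : ∀ p x : ℝ, p ^ 2 + x ^ 2 = 1 → !![p, -x, 0; x, p, 0; 0, 0, 1] ∈
      Matrix.specialOrthogonalGroup (Fin 3) ℝ := by
    intro p x h
    rw [Matrix.mem_specialOrthogonalGroup_iff, Matrix.mem_orthogonalGroup_iff]
    constructor
    · ext i j
      fin_cases i <;> fin_cases j <;>
        simp [Matrix.mul_apply, Fin.sum_univ_three, Matrix.star_eq_conjTranspose] <;>
        linarith
    · simp [Matrix.det_fin_three]
      linarith
  rw [e]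
  refine mul_mem (hz _ _ h2) (mul_mem ?_ (hz _ _ h3))
  rw [Matrix.mem_specialOrthogonalGroup_iff, Matrix.mem_orthogonalGroup_iff]
  constructor
  · ext i j
    fin_cases i <;> fin_cases j <;>
      simp [Matrix.mul_apply, Fin.sum_univ_three, Matrix.star_eq_conjTranspose] <;>
      linarith
  · simp [Matrix.det_fin_three]
    linarith

theorem hx_leg (c s p x q y l u : ℝ) (h1 : c ^ 2 + s ^ 2 = 1) (h2 : p ^ 2 + x ^ 2 = 1) :
    ‖l • Matrix.toEuclideanLin (hxZ c s p x q y) (!₂[0, 0, 1]) - u • !₂[(0 : ℝ), 0, 1]‖ =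
      Real.sqrt (l ^ 2 + u ^ 2 - 2 * l * u * c) := by
  rw [EuclideanSpace.norm_eq]
  congr 1
  simp [Fin.sum_univ_three, hxZ, Matrix.toLpLin_toLp, Matrix.mulVec, dotProduct]
  linear_combination l ^ 2 * s ^ 2 * h2 + l ^ 2 * h1

/-- Sufficiency part of item 2 of Theorem 6: a hexapod with collinear platform
points `m₁, …, m₅`, collinear base points `M₂, …, M₆` and the stated leg
lengths has a 2-dimensional spherical self-motion, obtained by placing `m₁` at
`M₆`. -/
theorem hexapod_item2_thm6
    (e f : E3) (he : ‖e‖ = 1) (hf : ‖f‖ = 1)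
    (c : ℝ) (hc : c ∈ Set.Ioo (-1 : ℝ) 1)
    (lam₂ lam₃ lam₄ lam₅ mu₂ mu₃ mu₄ mu₅ : ℝ) (m₁ m₆ M₁ M₆ : E3) :
    HasTwoDimSelfMotion
      (hexapodConfig
        ![m₁, m₁ + lam₂ • e, m₁ + lam₃ • e, m₁ + lam₄ • e, m₁ + lam₅ • e, m₆]
        ![M₁, M₆ + mu₂ • f, M₆ + mu₃ • f, M₆ + mu₄ • f, M₆ + mu₅ • f, M₆]
        ![‖M₆ - M₁‖,
          Real.sqrt (lam₂ ^ 2 + mu₂ ^ 2 - 2 * lam₂ * mu₂ * c),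
          Real.sqrt (lam₃ ^ 2 + mu₃ ^ 2 - 2 * lam₃ * mu₃ * c),
          Real.sqrt (lam₄ ^ 2 + mu₄ ^ 2 - 2 * lam₄ * mu₄ * c),
          Real.sqrt (lam₅ ^ 2 + mu₅ ^ 2 - 2 * lam₅ * mu₅ * c),
          ‖m₆ - m₁‖]) := by
  obtain ⟨A, hA, hAe⟩ := hx_frame' e he
  obtain ⟨B, hB, hBf⟩ := hx_frame' f hf
  obtain ⟨hc1, hc2⟩ := hc
  have hcs : 0 < 1 - c ^ 2 := by nlinarith
  obtain ⟨s, hs, hs2⟩ : ∃ s : ℝ, 0 < s ∧ c ^ 2 + s ^ 2 = 1 :=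
    ⟨Real.sqrt (1 - c ^ 2), Real.sqrt_pos.2 hcs, by rw [Real.sq_sqrt hcs.le]; ring⟩
  have hA' : star A * A = 1 := by
    rw [Matrix.mem_specialOrthogonalGroup_iff, Matrix.mem_orthogonalGroup_iff'] at hA
    exact hA.1
  have hB' : star B * B = 1 := by
    rw [Matrix.mem_specialOrthogonalGroup_iff, Matrix.mem_orthogonalGroup_iff'] at hB
    exact hB.1
  have hAs : star A ∈ Matrix.specialOrthogonalGroup (Fin 3) ℝ := by
    rw [Matrix.mem_specialOrthogonalGroup_iff, Matrix.mem_orthogonalGroup_iff] at hA ⊢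
    refine ⟨by simpa [Matrix.star_eq_conjTranspose] using hA', ?_⟩
    rw [Matrix.star_eq_conjTranspose, Matrix.det_conjTranspose, hA.2, star_one]
  let Z : E2 → Matrix (Fin 3) (Fin 3) ℝ := fun x =>
    hxZ c s (Real.sqrt (1 - x 0 ^ 2)) (x 0) (Real.sqrt (1 - x 1 ^ 2)) (x 1)
  have hZc : Continuous Z := by
    refine continuous_matrix fun i j => ?_
    fin_cases i <;> fin_cases j <;> simp [Z, hxZ] <;> fun_prop
  let Q : E2 → Matrix (Fin 3) (Fin 3) ℝ := fun x => B * Z x * star A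
  have hQc : Continuous Q := (continuous_const.matrix_mul hZc).matrix_mul continuous_const
  have hmv : Continuous fun x => Matrix.toEuclideanLin (Q x) m₁ := by
    have : Continuous fun x => (Q x).mulVec m₁.ofLp := hQc.matrix_mulVec continuous_const
    exact (PiLp.continuous_toLp 2 _).comp this
  have hball : ∀ x ∈ Metric.ball (0 : E2) 1, Real.sqrt (1 - x 0 ^ 2) ^ 2 + x 0 ^ 2 = 1 ∧
      Real.sqrt (1 - x 1 ^ 2) ^ 2 + x 1 ^ 2 = 1 := by
    intro x hx
    rw [mem_ball_zero_iff] at hx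
    have h := EuclideanSpace.real_norm_sq_eq x
    rw [Fin.sum_univ_two] at h
    have h0 : ‖x‖ ^ 2 < 1 := by nlinarith [norm_nonneg x]
    rw [Real.sq_sqrt (by nlinarith [sq_nonneg (x 1)]), Real.sq_sqrt (by nlinarith [sq_nonneg (x 0)])]
    constructor <;> ring
  refine ⟨fun x => (Q x, M₆ - Matrix.toEuclideanLin (Q x) m₁), ?_, ?_, ?_⟩
  · exact (hQc.prodMk (continuous_const.sub hmv)).continuousOn
  · intro x _ y _ hxy
    have hq : Q x = Q y := congrArg Prod.fst hxy
    have hz : Z x = Z y := by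
      have h := congrArg (fun N => star B * N * A) hq
      have e1 : ∀ N : Matrix (Fin 3) (Fin 3) ℝ, star B * (B * N * star A) * A = N := by
        intro N
        calc star B * (B * N * star A) * A = (star B * B) * N * (star A * A) := by
              simp only [Matrix.mul_assoc]
          _ = N := by rw [hA', hB', Matrix.one_mul, Matrix.mul_one]
      simpa only [Q, e1] using h
    have h0 := congrFun (congrFun hz 1) 2
    have h1 := congrFun (congrFun hz 2) 1
    simp [Z, hxZ, hs.ne'] at h0 h1
    ext i
    fin_cases i
    · exact h0
    · exact h1
  · intro x hx
    obtain ⟨hp, hq⟩ := hball x hx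
    have hZm : Z x ∈ Matrix.specialOrthogonalGroup (Fin 3) ℝ := hxZ_mem _ _ _ _ _ _ hs2 hp hq
    have hQm : Q x ∈ Matrix.specialOrthogonalGroup (Fin 3) ℝ := mul_mem (mul_mem hB hZm) hAs
    have hQe : Matrix.toEuclideanLin (Q x) e =
        Matrix.toEuclideanLin B (Matrix.toEuclideanLin (Z x) (!₂[0, 0, 1])) := by
      have hQA : Q x * A = B * Z x := by
        simp only [Q, Matrix.mul_assoc, hA', Matrix.mul_one]
      rw [← hAe]
      simp only [Matrix.toLpLin_toLp, Matrix.toLin'_apply, Matrix.mulVec_mulVec, hQA]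
    have key : ∀ l u : ℝ, ‖Matrix.toEuclideanLin (Q x) (m₁ + l • e) +
        (M₆ - Matrix.toEuclideanLin (Q x) m₁) - (M₆ + u • f)‖ =
        Real.sqrt (l ^ 2 + u ^ 2 - 2 * l * u * c) := by
      intro l u
      rw [← hx_leg c s _ _ (Real.sqrt (1 - x 1 ^ 2)) (x 1) l u hs2 hp,
        ← hx_norm B hB (l • _ - _)]
      congr 1
      rw [map_add, map_smul, hQe, map_sub, map_smul, map_smul, hBf]
      simp only [Z]
      abel
    refine ⟨hQm, fun i => ?_⟩
    fin_cases i
    · simp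
    · exact key _ _
    · exact key _ _
    · exact key _ _
    · exact key _ _
    · have := hx_norm (Q x) hQm (m₆ - m₁)
      rw [map_sub] at this
      rw [← this]
      simp only [Fin.reduceFinMk, Matrix.cons_val]
      congr 1
      abel

end
end
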